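/- arXiv:1406.4895 — 2 statements merged into one kernel-verified Lean document; each statement's English description precedes it below -/
import Mathlib

section
/- Let P' ⊆ ℝ^p be a nonempty 0/1-polytope and let (a, β) induce a symmetry of the cube. Suppose P' = {x ∈ ℝ^p : Ax ≤ b, ⟨a,x⟩ ≤ β} where A has k−1 rows (so in particular P' ⊆ H^≤(a,β)). Let φ_H be the reflection through H = {x : ⟨a,x⟩ = β}. Then the polytope Q = {(x,λ) ∈ ℝ^p × ℝ : Ax ≤ b, 0 ≤ λ ≤ β − ⟨a,x⟩}, described by k+1 inequalities, together with the linear map π(x,λ) = x + λ·(2/‖a‖²)·a, is a nice 0/1-extension of conv(P' ∪ φ_H(P')); consequently xcs(conv(P' ∪ φ_H(P'))) ≤ k + 1. -/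
/-- A 0/1-vector. -/
def IsZeroOneVec {ι : Type*} (x : ι → ℝ) : Prop := ∀ i, x i = 0 ∨ x i = 1

/-- A 0/1-polytope: the convex hull of a set of 0/1-vectors. -/
def IsZeroOnePolytope {ι : Type*} (Q : Set (ι → ℝ)) : Prop :=
  ∃ V : Set (ι → ℝ), (∀ x ∈ V, IsZeroOneVec x) ∧ Q = convexHull ℝ V

/-- `(Q, π)` is a nice 0/1-extension of `P`: `Q` is a 0/1-polytope, `π(Q) = P`,
every vertex (extreme point) of `Q` projects to a vertex of `P`, and each vertex
of `P` has exactly one vertex of `Q` projecting onto it. -/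
def IsNiceExtension {p : ℕ} {ι : Type*} (P : Set (Fin p → ℝ)) (Q : Set (ι → ℝ))
    (π : (ι → ℝ) →ₗ[ℝ] (Fin p → ℝ)) : Prop :=
  IsZeroOnePolytope Q ∧ π '' Q = P ∧
    (∀ y ∈ Set.extremePoints ℝ Q, π y ∈ Set.extremePoints ℝ P) ∧
    (∀ v ∈ Set.extremePoints ℝ P, ∃! y, y ∈ Set.extremePoints ℝ Q ∧ π y = v)

/-- `P` has a nice 0/1-extension `(Q, π)` where `Q` is described by `m` linear
inequalities together with finitely many linear equations. -/
def HasNiceDescrOfSize {p : ℕ} (P : Set (Fin p → ℝ)) (m : ℕ) : Prop :=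
  ∃ (q s : ℕ) (A : Matrix (Fin m) (Fin q) ℝ) (b : Fin m → ℝ)
    (C : Matrix (Fin s) (Fin q) ℝ) (d : Fin s → ℝ)
    (π : (Fin q → ℝ) →ₗ[ℝ] (Fin p → ℝ)),
    IsNiceExtension P {y | A.mulVec y ≤ b ∧ C.mulVec y = d} π

/-- The smallest size of a description of `Q` over all nice 0/1-extensions `(Q, π)` of `P`. -/
noncomputable def xcs {p : ℕ} (P : Set (Fin p → ℝ)) : ℕ :=
  sInf {m | HasNiceDescrOfSize P m}

/-- `(a, β)` induces a symmetry of the cube: either a coordinate flip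
(`a = 2σ eᵢ`, `β = σ`) or a coordinate swap (`a = σ(eᵢ - eⱼ)`, `β = 0`),
with `σ ∈ {+1, -1}`. -/
def InducesCubeSymmetry {p : ℕ} (a : Fin p → ℝ) (β : ℝ) : Prop :=
  (∃ (i : Fin p) (σ : ℝ), (σ = 1 ∨ σ = -1) ∧
    a = (2 * σ) • (Pi.single i 1 : Fin p → ℝ) ∧ β = σ) ∨
  (∃ (i j : Fin p) (σ : ℝ), i ≠ j ∧ (σ = 1 ∨ σ = -1) ∧
    a = σ • ((Pi.single i 1 : Fin p → ℝ) - (Pi.single j 1 : Fin p → ℝ)) ∧ β = 0)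

/-- A 0/1-polytope is contained in the unit cube. -/
theorem convexHull_subset_Icc_of_isZeroOneVec {ι : Type*} {V : Set (ι → ℝ)}
    (hV : ∀ x ∈ V, IsZeroOneVec x) : convexHull ℝ V ⊆ Set.Icc 0 1 := by
  refine convexHull_min (fun x hx => ⟨fun i => ?_, fun i => ?_⟩) (convex_Icc 0 1) <;>
    rcases hV x hx i with h | h <;> simp [h]

/-- A 0/1-vector is an extreme point of every subset of the unit cube containing it. -/
theorem IsZeroOneVec.mem_extremePoints {ι : Type*} {S : Set (ι → ℝ)} (hS : S ⊆ Set.Icc 0 1)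
    {x : ι → ℝ} (hx : IsZeroOneVec x) (hxS : x ∈ S) : x ∈ Set.extremePoints ℝ S := by
  refine ⟨hxS, fun y hy z hz h => ?_⟩
  obtain ⟨r, t, hr, ht, hrt, rfl⟩ := h
  funext i
  have hy0 : 0 ≤ y i := (hS hy).1 i
  have hy1 : y i ≤ 1 := (hS hy).2 i
  have hz0 : 0 ≤ z i := (hS hz).1 i
  have hz1 : z i ≤ 1 := (hS hz).2 i
  have hxi := hx i
  simp only [Pi.add_apply, Pi.smul_apply, smul_eq_mul] at hxi ⊢
  rcases hxi with h | h <;> rw [h]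
  · have : r * y i = 0 := by nlinarith [mul_nonneg hr.le hy0, mul_nonneg ht.le hz0]
    exact (mul_eq_zero.1 this).resolve_left hr.ne'
  · have : r * (1 - y i) = 0 := by
      nlinarith [mul_nonneg hr.le (sub_nonneg.2 hy1), mul_nonneg ht.le (sub_nonneg.2 hz1)]
    linarith [(mul_eq_zero.1 this).resolve_left hr.ne']

/-- The normal vector of a cube symmetry is nonzero. -/
theorem InducesCubeSymmetry.sum_sq_ne_zero {p : ℕ} {a : Fin p → ℝ} {β : ℝ}
    (h : InducesCubeSymmetry a β) : ∑ i, a i ^ 2 ≠ 0 := by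
  intro h0
  have ha : ∀ i, a i = 0 := fun i => by
    simpa using (Finset.sum_eq_zero_iff_of_nonneg fun i _ => sq_nonneg (a i)).1 h0 i
  rcases h with ⟨i, σ, hσ, rfl, -⟩ | ⟨i, j, σ, hij, hσ, rfl, -⟩
  · have := ha i
    rcases hσ with rfl | rfl <;> norm_num at this
  · have := ha i
    rcases hσ with rfl | rfl <;> simp [hij] at this

/-- The slack of a 0/1-vector in the half-space of a cube symmetry is 0 or 1, and the reflection
maps it to a 0/1-vector. -/
theorem InducesCubeSymmetry.slack_and_reflection {p : ℕ} {a : Fin p → ℝ} {β : ℝ}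
    (h : InducesCubeSymmetry a β) {x : Fin p → ℝ} (hx : IsZeroOneVec x)
    (hle : ∑ i, a i * x i ≤ β) :
    (β - ∑ i, a i * x i = 0 ∨ β - ∑ i, a i * x i = 1) ∧
      IsZeroOneVec (x + ((β - ∑ i, a i * x i) * (2 / ∑ i, a i ^ 2)) • a) := by
  rcases h with ⟨i, σ, hσ, rfl, rfl⟩ | ⟨i, j, σ, hij, hσ, rfl, rfl⟩
  · have hs : ∑ k, ((2 * β) • (Pi.single i 1 : Fin p → ℝ)) k * x k = 2 * β * x i := by
      simp [Pi.single_apply]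
    have hq : ∑ k, ((2 * β) • (Pi.single i 1 : Fin p → ℝ)) k ^ 2 = 4 := by
      rcases hσ with rfl | rfl <;> simp [Pi.single_apply, ite_pow] <;> norm_num
    rw [hs] at hle
    rw [hs, hq]
    have hβ : β - 2 * β * x i = 1 := by
      rcases hσ with rfl | rfl <;> rcases hx i with h | h <;> rw [h] at hle ⊢ <;> linarith
    refine ⟨Or.inr hβ, fun k => ?_⟩
    rw [hβ]
    by_cases hk : k = i
    · subst hk
      simp only [Pi.add_apply, Pi.smul_apply, Pi.single_eq_same, smul_eq_mul]
      rcases hσ with rfl | rfl <;> rcases hx k with h | h <;> rw [h] at hβ ⊢ <;>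
        first | (exfalso; linarith) | norm_num
    · simpa [hk] using hx k
  · have hs : ∑ k, (σ • ((Pi.single i 1 : Fin p → ℝ) - (Pi.single j 1 : Fin p → ℝ))) k * x k
        = σ * (x i - x j) := by
      simp [Pi.single_apply, mul_sub, sub_mul, Finset.sum_sub_distrib]
    have hq : ∑ k, (σ • ((Pi.single i 1 : Fin p → ℝ) - (Pi.single j 1 : Fin p → ℝ))) k ^ 2
        = 2 := by
      have hσ2 : σ ^ 2 = 1 := by rcases hσ with rfl | rfl <;> norm_num
      have : ∀ k, (σ • ((Pi.single i 1 : Fin p → ℝ) - (Pi.single j 1 : Fin p → ℝ))) k ^ 2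
          = (Pi.single i 1 : Fin p → ℝ) k + (Pi.single j 1 : Fin p → ℝ) k := fun k => by
        simp only [Pi.smul_apply, Pi.sub_apply, smul_eq_mul, mul_pow, hσ2, Pi.single_apply]
        split_ifs with h1 h2
        · exact absurd (h1.symm.trans h2) hij
        all_goals norm_num
      simp only [this, Finset.sum_add_distrib]
      simp
      norm_num
    rw [hs] at hle
    rw [hs, hq]
    refine ⟨?_, fun k => ?_⟩
    · rcases hσ with rfl | rfl <;> rcases hx i with h | h <;> rcases hx j with h' | h' <;>
        rw [h, h'] at hle ⊢ <;> first | (exfalso; linarith) | norm_num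
    · have hval : (x + ((0 - σ * (x i - x j)) * (2 / 2)) •
          (σ • ((Pi.single i 1 : Fin p → ℝ) - (Pi.single j 1 : Fin p → ℝ)))) k
          = x k + (x j - x i) * ((Pi.single i 1 : Fin p → ℝ) k - (Pi.single j 1 : Fin p → ℝ) k) := by
        rcases hσ with rfl | rfl <;> simp <;> ring
      rw [hval]
      by_cases hki : k = i
      · subst hki
        simpa [hij] using hx j
      · by_cases hkj : k = j
        · subst hkj
          simpa [hki] using hx i
        · simpa [hki, hkj] using hx k

/-- The slack function of a half-space is affine. -/
theorem slack_combo {p : ℕ} (a : Fin p → ℝ) (β : ℝ) (x y : Fin p → ℝ) {r t : ℝ} (h : r + t = 1) :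
    β - ∑ i, a i * (r • x + t • y) i
      = r * (β - ∑ i, a i * x i) + t * (β - ∑ i, a i * y i) := by
  have : ∑ i, a i * (r • x + t • y) i = r * ∑ i, a i * x i + t * ∑ i, a i * y i := by
    simp only [Finset.mul_sum, ← Finset.sum_add_distrib, Pi.add_apply, Pi.smul_apply, smul_eq_mul]
    exact Finset.sum_congr rfl fun i _ => by ring
  rw [this]
  linear_combination (-β) * h

/-- The region between the graphs of `0` and of the slack function over `convexHull ℝ V` is the
convex hull of the points of these graphs over `V`. -/
theorem convexHull_graphs_of_slack {p : ℕ} (V : Set (Fin p → ℝ)) (a : Fin p → ℝ) (β : ℝ)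
    (hV : ∀ v ∈ V, ∑ i, a i * v i ≤ β) :
    {y : Fin (p + 1) → ℝ | Fin.init (α := fun _ => ℝ) y ∈ convexHull ℝ V ∧ 0 ≤ y (Fin.last p) ∧
        y (Fin.last p) ≤ β - ∑ i, a i * y i.castSucc} =
      convexHull ℝ {y : Fin (p + 1) → ℝ | Fin.init (α := fun _ => ℝ) y ∈ V ∧
        (y (Fin.last p) = 0 ∨ y (Fin.last p) = β - ∑ i, a i * y i.castSucc)} := by
  set W := {y : Fin (p + 1) → ℝ | Fin.init (α := fun _ => ℝ) y ∈ V ∧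
        (y (Fin.last p) = 0 ∨ y (Fin.last p) = β - ∑ i, a i * y i.castSucc)} with hW
  apply Set.Subset.antisymm
  · rintro y ⟨hy, h0, h1⟩
    have key : ∀ c : ℝ, c = 0 ∨ c = 1 → ∀ x ∈ convexHull ℝ V,
        (Fin.snoc (α := fun _ => ℝ) x (c * (β - ∑ i, a i * x i)) : Fin (p + 1) → ℝ)
          ∈ convexHull ℝ W := by
      intro c hc
      refine convexHull_min (t := {x | (Fin.snoc (α := fun _ => ℝ) x
        (c * (β - ∑ i, a i * x i)) : Fin (p + 1) → ℝ) ∈ convexHull ℝ W}) ?_ ?_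
      · intro v hv
        apply subset_convexHull
        refine ⟨by simpa using hv, ?_⟩
        rcases hc with rfl | rfl <;> simp
      · intro x hx z hz r t hr ht hrt
        have := (convex_convexHull ℝ W) hx hz hr ht hrt
        simp only [Set.mem_ofPred_eq]
        convert this using 1
        rw [slack_combo a β x z hrt]
        funext k
        refine Fin.lastCases ?_ (fun k => ?_) k
        · simp only [Fin.snoc_last, Pi.add_apply, Pi.smul_apply, smul_eq_mul]
          ring
        · simp
    have hA := key 0 (Or.inl rfl) _ hy
    have hB := key 1 (Or.inr rfl) _ hy
    have hi : ∑ i, a i * Fin.init (α := fun _ => ℝ) y i = ∑ i, a i * y i.castSucc := rfl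
    rw [hi] at hA hB
    set s := β - ∑ i, a i * y i.castSucc with hs
    have hs0 : 0 ≤ s := h0.trans h1
    rcases hs0.eq_or_lt with h | h
    · convert hA using 1
      have hl : y (Fin.last p) = 0 * s := by linarith
      rw [← hl]
      exact (Fin.snoc_init_self y).symm
    · have := (convex_convexHull ℝ W) hA hB (a := 1 - y (Fin.last p) / s)
        (b := y (Fin.last p) / s) (sub_nonneg.2 ((div_le_one h).2 h1)) (div_nonneg h0 hs0)
        (by ring)
      convert this using 1
      funext k
      refine Fin.lastCases ?_ (fun k => ?_) k
      · simp only [Fin.snoc_last, Pi.add_apply, Pi.smul_apply, smul_eq_mul]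
        field_simp
        ring
      · simp only [Fin.snoc_castSucc, Pi.add_apply, Pi.smul_apply, smul_eq_mul, Fin.init]
        ring
  · refine convexHull_min ?_ ?_
    · rintro y ⟨hy, h⟩
      have : ∑ i, a i * y i.castSucc ≤ β := hV _ hy
      refine ⟨subset_convexHull ℝ V hy, ?_⟩
      rcases h with h | h <;> rw [h] <;> constructor <;> linarith
    · rintro x ⟨hx, hx0, hx1⟩ z ⟨hz, hz0, hz1⟩ r t hr ht hrt
      refine ⟨(convex_convexHull ℝ V) hx hz hr ht hrt, ?_, ?_⟩
      · exact add_nonneg (mul_nonneg hr hx0) (mul_nonneg ht hz0)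
      · have := slack_combo a β (Fin.init (α := fun _ => ℝ) x) (Fin.init (α := fun _ => ℝ) z) hrt
        calc (r • x + t • z) (Fin.last p)
            ≤ r * (β - ∑ i, a i * x i.castSucc) + t * (β - ∑ i, a i * z i.castSucc) :=
              add_le_add (mul_le_mul_of_nonneg_left hx1 hr) (mul_le_mul_of_nonneg_left hz1 ht)
          _ = _ := this.symm

/-- If a linear map sends a set of 0/1-vectors injectively to 0/1-vectors, then it exhibits the
convex hull of the set as a nice 0/1-extension of the convex hull of the image. -/
theorem isNiceExtension_convexHull {p : ℕ} {ι : Type*} {W : Set (ι → ℝ)}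
    (π : (ι → ℝ) →ₗ[ℝ] (Fin p → ℝ)) (hW : ∀ y ∈ W, IsZeroOneVec y)
    (hπ : ∀ y ∈ W, IsZeroOneVec (π y)) (hinj : Set.InjOn π W) :
    IsNiceExtension (convexHull ℝ (π '' W)) (convexHull ℝ W) π := by
  have hπW : ∀ x ∈ π '' W, IsZeroOneVec x := by
    rintro _ ⟨y, hy, rfl⟩
    exact hπ y hy
  refine ⟨⟨W, hW, rfl⟩, π.image_convexHull W, fun y hy => ?_, fun v hv => ?_⟩
  · have hyW := extremePoints_convexHull_subset hy
    exact (hπ y hyW).mem_extremePoints (convexHull_subset_Icc_of_isZeroOneVec hπW)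
      (subset_convexHull ℝ _ ⟨y, hyW, rfl⟩)
  · obtain ⟨y, hy, rfl⟩ := extremePoints_convexHull_subset hv
    refine ⟨y, ⟨(hW y hy).mem_extremePoints (convexHull_subset_Icc_of_isZeroOneVec hW)
      (subset_convexHull ℝ _ hy), rfl⟩, ?_⟩
    rintro z ⟨hz, hzy⟩
    exact hinj (extremePoints_convexHull_subset hz) hy hzy

/-- A polyhedron `{(x, l) : A x ≤ b, 0 ≤ l ≤ β - ⟨a, x⟩}` is described by two inequalities more
than `A x ≤ b`. -/
theorem hasNiceDescrOfSize_of_slack {p m : ℕ} {P : Set (Fin p → ℝ)} (a : Fin p → ℝ) (β : ℝ)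
    (A : Matrix (Fin m) (Fin p) ℝ) (b : Fin m → ℝ) (π : (Fin (p + 1) → ℝ) →ₗ[ℝ] (Fin p → ℝ))
    (h : IsNiceExtension P {y | A.mulVec (fun i : Fin p => y i.castSucc) ≤ b ∧
        0 ≤ y (Fin.last p) ∧ y (Fin.last p) ≤ β - ∑ i, a i * y i.castSucc} π) :
    HasNiceDescrOfSize P (m + 2) := by
  refine ⟨p + 1, 0, Matrix.of (Fin.cons (Fin.snoc (α := fun _ => ℝ) 0 (-1))
    (Fin.cons (Fin.snoc (α := fun _ => ℝ) a 1) fun k => Fin.snoc (α := fun _ => ℝ) (A k) 0)),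
    Fin.cons 0 (Fin.cons β b), 0, 0, π, ?_⟩
  convert h using 1
  ext y
  simp only [Set.mem_ofPred_eq, Pi.le_def, Fin.forall_fin_succ, Matrix.mulVec, dotProduct,
    Matrix.of_apply, Fin.cons_zero, Fin.cons_succ, Fin.sum_univ_castSucc, Fin.snoc_castSucc,
    Fin.snoc_last]
  constructor
  · rintro ⟨⟨h0, h1, h2⟩, -⟩
    refine ⟨fun k => by simpa using h2 k, ?_, by linarith⟩
    simpa using h0
  · rintro ⟨h2, h0, h1⟩
    exact ⟨⟨by simpa using h0, by linarith, fun k => by simpa using h2 k⟩, Subsingleton.elim _ _⟩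

/-- If the nonempty 0/1-polytope `P'` is described as
`{x : Ax ≤ b, ⟨a,x⟩ ≤ β}` where `A` has `m` rows and `(a, β)` induces a symmetry
of the cube, then `Q = {(x,λ) : Ax ≤ b, 0 ≤ λ ≤ β - ⟨a,x⟩}` (described by `m + 2`
inequalities) together with `π(x,λ) = x + λ·(2/‖a‖²)·a` is a nice 0/1-extension
of `conv(P' ∪ φ_H(P'))`; consequently `xcs(conv(P' ∪ φ_H(P'))) ≤ m + 2`. -/
theorem stmt7 {p m : ℕ} (P' : Set (Fin p → ℝ)) (h01 : IsZeroOnePolytope P') (hne : P'.Nonempty)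
    (a : Fin p → ℝ) (β : ℝ) (hsym : InducesCubeSymmetry a β)
    (A : Matrix (Fin m) (Fin p) ℝ) (b : Fin m → ℝ)
    (hdescr : P' = {x | A.mulVec x ≤ b ∧ (∑ i, a i * x i) ≤ β})
    (φ : (Fin p → ℝ) → (Fin p → ℝ))
    (hφ : ∀ x, φ x = x + (2 * (β - ∑ i, a i * x i) / (∑ i, a i ^ 2)) • a)
    (Q : Set (Fin (p + 1) → ℝ))
    (hQ : Q = {y | A.mulVec (fun i : Fin p => y i.castSucc) ≤ b ∧
        0 ≤ y (Fin.last p) ∧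
        y (Fin.last p) ≤ β - ∑ i, a i * y i.castSucc})
    (π : (Fin (p + 1) → ℝ) →ₗ[ℝ] (Fin p → ℝ))
    (hπ : ∀ y, π y = (fun i : Fin p => y i.castSucc) +
        (y (Fin.last p) * (2 / ∑ i, a i ^ 2)) • a) :
    IsNiceExtension (convexHull ℝ (P' ∪ φ '' P')) Q π ∧
    xcs (convexHull ℝ (P' ∪ φ '' P')) ≤ m + 2 := by
  obtain ⟨V, hV, hPV⟩ := h01
  have hle : ∀ x ∈ P', ∑ i, a i * x i ≤ β := fun x hx => by
    rw [hdescr] at hx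
    exact hx.2
  have hVP : V ⊆ P' := hPV ▸ subset_convexHull ℝ V
  have hN := hsym.sum_sq_ne_zero
  set N := ∑ i, a i ^ 2 with hNdef
  set W := {y : Fin (p + 1) → ℝ | Fin.init (α := fun _ => ℝ) y ∈ V ∧
        (y (Fin.last p) = 0 ∨ y (Fin.last p) = β - ∑ i, a i * y i.castSucc)} with hW
  have hQW : Q = convexHull ℝ W := by
    rw [hW, ← convexHull_graphs_of_slack V a β fun v hv => hle v (hVP hv), hQ, ← hPV, hdescr]
    ext y
    constructor
    · rintro ⟨h1, h2, h3⟩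
      exact ⟨⟨h1, sub_nonneg.1 (h2.trans h3)⟩, h2, h3⟩
    · rintro ⟨⟨h1, -⟩, h2, h3⟩
      exact ⟨h1, h2, h3⟩
  have hφ' : ∀ x, φ x = x + ((β - ∑ i, a i * x i) * (2 / N)) • a := fun x => by
    rw [hφ]
    congr 2
    ring
  have hπ' : ∀ y, y (Fin.last p) = 0 ∧ π y = Fin.init (α := fun _ => ℝ) y ∨
      y (Fin.last p) = β - ∑ i, a i * y i.castSucc ∧ π y = φ (Fin.init (α := fun _ => ℝ) y) ∨
      y ∉ W := fun y => by
    by_cases hy : y ∈ W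
    · rcases hy.2 with h | h
      · exact Or.inl ⟨h, by rw [hπ, h]; simp [Fin.init_def]⟩
      · exact Or.inr (Or.inl ⟨h, by rw [hπ, h, hφ']; rfl⟩)
    · exact Or.inr (Or.inr hy)
  have hφV : ∀ v ∈ V, IsZeroOneVec (φ v) := fun v hv => by
    rw [hφ']
    exact (hsym.slack_and_reflection (hV v hv) (hle v (hVP hv))).2
  have hslack : ∀ y ∈ W, β - ∑ i, a i * y i.castSucc = 0 ∨ β - ∑ i, a i * y i.castSucc = 1 :=
    fun y hy => (hsym.slack_and_reflection (hV _ hy.1) (hle _ (hVP hy.1))).1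
  have hW01 : ∀ y ∈ W, IsZeroOneVec y := fun y hy k => by
    refine Fin.lastCases ?_ (fun k => hV _ hy.1 k) k
    rcases hy.2 with h | h
    · exact Or.inl h
    · rw [h]
      exact hslack y hy
  have hπ01 : ∀ y ∈ W, IsZeroOneVec (π y) := fun y hy => by
    rcases hπ' y with ⟨-, h⟩ | ⟨-, h⟩ | h
    · rw [h]
      exact hV _ hy.1
    · rw [h]
      exact hφV _ hy.1
    · exact absurd hy h
  have hslackπ : ∀ y, β - ∑ i, a i * π y i
      = (β - ∑ i, a i * y i.castSucc) - 2 * y (Fin.last p) := fun y => by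
    have : ∑ i, a i * π y i = ∑ i, a i * y i.castSucc + y (Fin.last p) * (2 / N) * N := by
      rw [hπ, hNdef, Finset.mul_sum, ← Finset.sum_add_distrib]
      exact Finset.sum_congr rfl fun i _ => by
        simp only [Pi.add_apply, Pi.smul_apply, smul_eq_mul]
        ring
    rw [this]
    field_simp
    ring
  have hinj : Set.InjOn π W := by
    intro y hy z hz hyz
    have hlast : y (Fin.last p) = z (Fin.last p) := by
      have h1 := hslackπ y
      rw [hyz, hslackπ z] at h1
      rcases hy.2 with h2 | h2 <;> rcases hz.2 with h3 | h3 <;>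
        rcases hslack y hy with h4 | h4 <;> rcases hslack z hz with h5 | h5 <;> linarith
    rw [hπ, hπ, hlast] at hyz
    funext k
    exact Fin.lastCases hlast (fun k => congrFun (add_right_cancel hyz) k) k
  have himg : π '' W = V ∪ φ '' V := by
    apply Set.Subset.antisymm
    · rintro _ ⟨y, hy, rfl⟩
      rcases hπ' y with ⟨-, h⟩ | ⟨-, h⟩ | h
      · exact Or.inl (h ▸ hy.1)
      · exact Or.inr ⟨_, hy.1, h.symm⟩
      · exact absurd hy h
    · rintro x (hx | ⟨v, hv, rfl⟩)
      · refine ⟨Fin.snoc (α := fun _ => ℝ) x 0, ⟨by simpa using hx, by simp⟩, ?_⟩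
        rw [hπ]
        simp
      · refine ⟨Fin.snoc (α := fun _ => ℝ) v (β - ∑ i, a i * v i),
          ⟨by simpa using hv, by simp⟩, ?_⟩
        rw [hπ, hφ']
        simp
  have hhull : convexHull ℝ (P' ∪ φ '' P') = convexHull ℝ (π '' W) := by
    rw [himg]
    apply Set.Subset.antisymm
    · refine convexHull_min (Set.union_subset ?_ ?_) (convex_convexHull ℝ _)
      · rw [hPV]
        exact convexHull_mono Set.subset_union_left
      · rw [Set.image_subset_iff, hPV]
        refine convexHull_min (fun v hv => subset_convexHull ℝ _ (Or.inr ⟨v, hv, rfl⟩)) ?_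
        intro x hx z hz r t hr ht hrt
        have := (convex_convexHull ℝ (V ∪ φ '' V)) hx hz hr ht hrt
        simp only [Set.mem_preimage]
        convert this using 1
        rw [hφ', hφ', hφ', slack_combo a β x z hrt]
        module
    · exact convexHull_mono (Set.union_subset_union hVP (Set.image_mono hVP))
  have hnice : IsNiceExtension (convexHull ℝ (P' ∪ φ '' P')) Q π := by
    rw [hhull, hQW]
    exact isNiceExtension_convexHull π hW01 hπ01 hinj
  exact ⟨hnice, Nat.sInf_le (hasNiceDescrOfSize_of_slack a β A b π (hQ ▸ hnice))⟩
end

section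
/- Let P' ⊆ ℝ^p be a nonempty 0/1-polytope and j ∈ {1,…,p} such that the map down_j (which sets the j-th coordinate to 0 and keeps all other coordinates) is injective on the set of vertices of P'. Then xcs(conv(P' ∪ down_j(P'))) ≤ xcs(P') + 2. -/
theorem IsZeroOneVec.mem_extremePoints_s8 {ι : Type*} {V : Set (ι → ℝ)}
    (hV : ∀ x ∈ V, IsZeroOneVec x) {v : ι → ℝ} (hv : v ∈ V) :
    v ∈ Set.extremePoints ℝ (convexHull ℝ V) := by
  have hcube : convexHull ℝ V ⊆ Set.Icc 0 1 := by
    refine convexHull_min (fun x hx => ?_) (convex_Icc 0 1)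
    refine ⟨fun i => ?_, fun i => ?_⟩ <;> rcases hV x hx i with h | h <;> simp [h]
  refine ⟨subset_convexHull ℝ V hv, ?_⟩
  rintro x hx y hy ⟨a, b, ha, hb, hab, rfl⟩
  funext i
  have hx0 : 0 ≤ x i := (hcube hx).1 i
  have hx1 : x i ≤ 1 := (hcube hx).2 i
  have hy0 : 0 ≤ y i := (hcube hy).1 i
  have hy1 : y i ≤ 1 := (hcube hy).2 i
  have hi := hV _ hv i
  simp only [Pi.add_apply, Pi.smul_apply, smul_eq_mul] at hi ⊢
  rcases hi with h | h
  · have h1 : x i = 0 := by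
      by_contra hne
      have := mul_pos ha (lt_of_le_of_ne hx0 (Ne.symm hne))
      nlinarith [mul_nonneg hb.le hy0]
    linarith
  · have h1 : x i = 1 := by
      by_contra hne
      have := mul_pos ha (sub_pos.2 (lt_of_le_of_ne hx1 hne))
      nlinarith [mul_nonneg hb.le (sub_nonneg.2 hy1)]
    linarith

theorem extremePoints_convexHull_of_isZeroOneVec {ι : Type*} {V : Set (ι → ℝ)}
    (hV : ∀ x ∈ V, IsZeroOneVec x) : Set.extremePoints ℝ (convexHull ℝ V) = V :=
  Set.Subset.antisymm extremePoints_convexHull_subset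
    fun _ hv => IsZeroOneVec.mem_extremePoints_s8 hV hv

theorem isNiceExtension_convexHull_of_bijOn {p : ℕ} {ι : Type*} {V : Set (Fin p → ℝ)}
    {W : Set (ι → ℝ)} {π : (ι → ℝ) →ₗ[ℝ] (Fin p → ℝ)} (hV : ∀ x ∈ V, IsZeroOneVec x)
    (hW : ∀ x ∈ W, IsZeroOneVec x) (hπ : Set.BijOn π W V) :
    IsNiceExtension (convexHull ℝ V) (convexHull ℝ W) π := by
  refine ⟨⟨W, hW, rfl⟩, ?_, ?_, ?_⟩
  · rw [π.image_convexHull, hπ.image_eq]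
  · rw [extremePoints_convexHull_of_isZeroOneVec hV, extremePoints_convexHull_of_isZeroOneVec hW]
    exact hπ.mapsTo
  · rw [extremePoints_convexHull_of_isZeroOneVec hV, extremePoints_convexHull_of_isZeroOneVec hW]
    intro v hv
    obtain ⟨y, hy, rfl⟩ := hπ.surjOn hv
    exact ⟨y, ⟨hy, rfl⟩, fun z hz => hπ.injOn hz.1 hy hz.2⟩

theorem IsNiceExtension.exists_bijOn {p : ℕ} {ι : Type*} {V : Set (Fin p → ℝ)}
    {Q : Set (ι → ℝ)} {π : (ι → ℝ) →ₗ[ℝ] (Fin p → ℝ)} (hV : ∀ x ∈ V, IsZeroOneVec x)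
    (h : IsNiceExtension (convexHull ℝ V) Q π) :
    ∃ W : Set (ι → ℝ), (∀ x ∈ W, IsZeroOneVec x) ∧ Q = convexHull ℝ W ∧ Set.BijOn π W V := by
  obtain ⟨⟨W, hW, rfl⟩, -, hmaps, huniq⟩ := h
  rw [extremePoints_convexHull_of_isZeroOneVec hV,
    extremePoints_convexHull_of_isZeroOneVec hW] at hmaps huniq
  refine ⟨W, hW, rfl, hmaps, fun y hy z hz hyz => ?_, fun v hv => ?_⟩
  · exact (huniq _ (hmaps z hz)).unique ⟨hy, hyz⟩ ⟨hz, rfl⟩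
  · obtain ⟨y, hy, -⟩ := huniq v hv
    exact ⟨y, hy⟩

theorem hasNiceDescrOfSize_of_linearMap {p q m s : ℕ} {P : Set (Fin p → ℝ)}
    {Q : Set (Fin q → ℝ)} (f : Fin m → (Fin q → ℝ) →ₗ[ℝ] ℝ) (b : Fin m → ℝ)
    (g : (Fin q → ℝ) →ₗ[ℝ] (Fin s → ℝ)) (d : Fin s → ℝ)
    (hQ : ∀ y, y ∈ Q ↔ (∀ i, f i y ≤ b i) ∧ g y = d)
    (π : (Fin q → ℝ) →ₗ[ℝ] (Fin p → ℝ)) (h : IsNiceExtension P Q π) :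
    HasNiceDescrOfSize P m := by
  refine ⟨q, s, LinearMap.toMatrix' (LinearMap.pi f), b, LinearMap.toMatrix' g, d, π, ?_⟩
  convert h using 1
  ext y
  simp only [LinearMap.toMatrix'_mulVec, Set.mem_ofPred_eq, hQ, Pi.le_def, LinearMap.pi_apply]

/-- The standard simplex over the vertices is a nice extension. -/
theorem IsZeroOnePolytope.exists_hasNiceDescrOfSize {p : ℕ} {P : Set (Fin p → ℝ)}
    (hP : IsZeroOnePolytope P) : ∃ m, HasNiceDescrOfSize P m := by
  obtain ⟨V, hV, rfl⟩ := hP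
  have hfin : V.Finite := by
    refine (Set.Finite.pi' (t := fun _ : Fin p => ({0, 1} : Set ℝ))
      fun _ => Set.toFinite _).subset fun x hx i => ?_
    simpa using hV x hx i
  obtain ⟨n, v, hvinj, rfl⟩ := hfin.fin_param
  refine ⟨n, hasNiceDescrOfSize_of_linearMap (s := 1) (Q := stdSimplex ℝ (Fin n))
    (fun i => -LinearMap.proj i) 0 (LinearMap.pi fun _ => ∑ i, LinearMap.proj i) 1 ?_
    (Fintype.linearCombination ℝ v) ?_⟩
  · intro y
    simp [stdSimplex, funext_iff]
  · rw [← convexHull_rangle_single_eq_stdSimplex]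
    refine isNiceExtension_convexHull_of_bijOn hV ?_ ⟨?_, ?_, ?_⟩
    · rintro _ ⟨i, rfl⟩ k
      by_cases hk : k = i
      · subst hk; simp
      · simp [hk]
    · rintro _ ⟨i, rfl⟩
      exact ⟨i, by simp⟩
    · rintro _ ⟨i, rfl⟩ _ ⟨k, rfl⟩ hik
      have : v i = v k := by simpa using hik
      rw [hvinj this]
    · rintro _ ⟨i, rfl⟩
      exact ⟨Pi.single i 1, ⟨i, rfl⟩, by simp⟩

/-- The region between `0` and a linear functional over a convex hull is the convex hull of the
two graphs over the generating set. -/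
theorem mem_convexHull_cons_iff {q : ℕ} {W : Set (Fin q → ℝ)} (l : (Fin q → ℝ) →ₗ[ℝ] ℝ)
    (hl : ∀ y ∈ W, 0 ≤ l y) (x : Fin (q + 1) → ℝ) :
    x ∈ convexHull ℝ ((fun y => (Fin.cons 0 y : Fin (q + 1) → ℝ)) '' W ∪
        (fun y => (Fin.cons (l y) y : Fin (q + 1) → ℝ)) '' W) ↔
      0 ≤ x 0 ∧ x 0 ≤ l (Fin.tail x) ∧ Fin.tail x ∈ convexHull ℝ W := by
  let tl : (Fin (q + 1) → ℝ) →ₗ[ℝ] (Fin q → ℝ) := LinearMap.funLeft ℝ ℝ Fin.succ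
  have htl : ∀ x, tl x = Fin.tail x := fun _ => rfl
  let graph (k : (Fin q → ℝ) →ₗ[ℝ] ℝ) : (Fin q → ℝ) →ₗ[ℝ] (Fin (q + 1) → ℝ) :=
    LinearMap.pi (Fin.cons k fun i => LinearMap.proj i)
  have hgraph : ∀ k y, graph k y = Fin.cons (k y) y := by
    intro k y
    funext i
    cases i using Fin.cases <;> simp [graph]
  constructor
  · have hconv : Convex ℝ {x : Fin (q + 1) → ℝ | 0 ≤ x 0 ∧ x 0 ≤ l (Fin.tail x) ∧
        Fin.tail x ∈ convexHull ℝ W} := by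
      have h0 : Convex ℝ {x : Fin (q + 1) → ℝ | 0 ≤ x 0} :=
        convex_halfSpace_ge (LinearMap.proj 0 : (Fin (q + 1) → ℝ) →ₗ[ℝ] ℝ).isLinear 0
      have h1 : Convex ℝ {x : Fin (q + 1) → ℝ | x 0 ≤ l (Fin.tail x)} := by
        have := convex_halfSpace_le (LinearMap.proj 0 - l ∘ₗ tl).isLinear 0
        simpa [htl] using this
      exact h0.inter (h1.inter ((convex_convexHull ℝ W).linear_preimage tl))
    refine fun hx => convexHull_min ?_ hconv hx
    rintro _ (⟨y, hy, rfl⟩ | ⟨y, hy, rfl⟩)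
    · exact ⟨by simp, by simpa using hl y hy, by simpa using subset_convexHull ℝ W hy⟩
    · exact ⟨by simpa using hl y hy, by simp, by simpa using subset_convexHull ℝ W hy⟩
  · rintro ⟨h0, h1, hmem⟩
    set y := Fin.tail x with hy
    have hx : x = Fin.cons (x 0) y := (Fin.cons_self_tail x).symm
    have hgraph_mem : ∀ k : (Fin q → ℝ) →ₗ[ℝ] ℝ, (Fin.cons (k y) y : Fin (q + 1) → ℝ) ∈
        convexHull ℝ ((fun y => (Fin.cons (k y) y : Fin (q + 1) → ℝ)) '' W) := by
      intro k
      have := Set.mem_image_of_mem (graph k) hmem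
      rw [(graph k).image_convexHull] at this
      simpa only [hgraph] using this
    have hbot := convexHull_mono (Set.subset_union_left
      (t := (fun y => (Fin.cons (l y) y : Fin (q + 1) → ℝ)) '' W)) (hgraph_mem 0)
    have htop := convexHull_mono (Set.subset_union_right
      (s := (fun y => (Fin.cons 0 y : Fin (q + 1) → ℝ)) '' W)) (hgraph_mem l)
    refine (convex_convexHull ℝ _).segment_subset hbot htop ?_
    obtain ⟨a, b, ha, hb, hab, hz⟩ : x 0 ∈ segment ℝ 0 (l y) := by
      rw [segment_eq_Icc (h0.trans h1)]; exact ⟨h0, h1⟩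
    refine ⟨a, b, ha, hb, hab, ?_⟩
    rw [hx, ← hz]
    funext i
    cases i using Fin.cases with
    | zero => simp
    | succ i => simp [← add_mul, hab]

theorem HasNiceDescrOfSize.convexHull_union_down {p m : ℕ} {P' : Set (Fin p → ℝ)}
    (h01 : IsZeroOnePolytope P') (j : Fin p)
    (hinj : Set.InjOn (fun x : Fin p → ℝ => Function.update x j 0) (Set.extremePoints ℝ P'))
    (h : HasNiceDescrOfSize P' m) :
    HasNiceDescrOfSize
      (convexHull ℝ (P' ∪ (fun x : Fin p → ℝ => Function.update x j 0) '' P')) (m + 2) := by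
  obtain ⟨V, hV, rfl⟩ := h01
  rw [extremePoints_convexHull_of_isZeroOneVec hV] at hinj
  obtain ⟨q, s, A, b, C, d, π, hnice⟩ := h
  obtain ⟨W, hW, hQ, hπ⟩ := hnice.exists_bijOn hV
  let upd : ℝ × (Fin p → ℝ) →ₗ[ℝ] (Fin p → ℝ) :=
    LinearMap.pi fun i => if i = j then LinearMap.fst ℝ ℝ _ else
      LinearMap.proj i ∘ₗ LinearMap.snd ℝ ℝ _
  have hupd : ∀ z x, upd (z, x) = Function.update x j z := by
    intro z x
    funext i
    by_cases hi : i = j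
    · subst hi; simp [upd]
    · simp [upd, hi]
  let tl : (Fin (q + 1) → ℝ) →ₗ[ℝ] (Fin q → ℝ) := LinearMap.funLeft ℝ ℝ Fin.succ
  have htl : ∀ x, tl x = Fin.tail x := fun _ => rfl
  let l : (Fin q → ℝ) →ₗ[ℝ] ℝ := LinearMap.proj j ∘ₗ π
  have hl : ∀ y, l y = π y j := fun _ => rfl
  have hl01 : ∀ y ∈ W, l y = 0 ∨ l y = 1 := fun y hy => hV _ (hπ.mapsTo hy) j
  let ρ : (Fin (q + 1) → ℝ) →ₗ[ℝ] (Fin p → ℝ) :=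
    upd ∘ₗ (LinearMap.proj 0).prod (π ∘ₗ tl)
  have hρ : ∀ z y, ρ (Fin.cons z y) = Function.update (π y) j z := fun z y => hupd z (π y)
  have hP : convexHull ℝ (convexHull ℝ V ∪
      (fun x : Fin p → ℝ => Function.update x j 0) '' convexHull ℝ V) =
      convexHull ℝ (V ∪ (fun x : Fin p → ℝ => Function.update x j 0) '' V) := by
    have hdown : (fun x : Fin p → ℝ => Function.update x j 0) =
        upd ∘ₗ LinearMap.inr ℝ ℝ (Fin p → ℝ) := funext fun x => (hupd 0 x).symm
    rw [hdown, LinearMap.image_convexHull]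
    exact (convexHull ℝ).closure_sup_closure _ _
  rw [hP]
  refine hasNiceDescrOfSize_of_linearMap
    (Fin.cons (-LinearMap.proj 0) (Fin.cons (LinearMap.proj 0 - l ∘ₗ tl)
      fun i => LinearMap.proj i ∘ₗ Matrix.mulVecLin A ∘ₗ tl))
    (Fin.cons 0 (Fin.cons 0 b)) (Matrix.mulVecLin C ∘ₗ tl) d (fun x => ?_) ρ
    (isNiceExtension_convexHull_of_bijOn (W := (fun y => (Fin.cons 0 y : Fin (q + 1) → ℝ)) '' W ∪
        (fun y => (Fin.cons (l y) y : Fin (q + 1) → ℝ)) '' W) ?_ ?_ ⟨?_, ?_, ?_⟩)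
  · rw [mem_convexHull_cons_iff l, ← hQ]
    · simp [Fin.forall_fin_succ, htl, Pi.le_def, and_assoc]
    · intro y hy
      rcases hl01 y hy with h | h <;> simp [h]
  · rintro _ (hx | ⟨x, hx, rfl⟩)
    · exact hV _ hx
    · intro i
      by_cases hi : i = j
      · subst hi; simp
      · simpa [hi] using hV x hx i
  · rintro _ (⟨y, hy, rfl⟩ | ⟨y, hy, rfl⟩) i
    · cases i using Fin.cases with
      | zero => simp
      | succ i => simpa using hW y hy i
    · cases i using Fin.cases with
      | zero => simpa using hl01 y hy
      | succ i => simpa using hW y hy i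
  · rintro _ (⟨y, hy, rfl⟩ | ⟨y, hy, rfl⟩)
    · exact Or.inr ⟨π y, hπ.mapsTo hy, (hρ 0 y).symm⟩
    · refine Or.inl ?_
      simpa [hρ, hl] using hπ.mapsTo hy
  · have key : ∀ y ∈ W, ∀ y' ∈ W, ∀ z z' : ℝ,
        ρ (Fin.cons z y) = ρ (Fin.cons z' y') →
          (Fin.cons z y : Fin (q + 1) → ℝ) = Fin.cons z' y' := by
      intro y hy y' hy' z z' heq
      rw [hρ, hρ] at heq
      have hz : z = z' := by simpa using congrFun heq j
      have hdown : Function.update (π y) j 0 = Function.update (π y') j 0 := by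
        simpa using congrArg (fun x => Function.update x j 0) heq
      have hy_eq : y = y' :=
        hπ.injOn hy hy' (hinj (hπ.mapsTo hy) (hπ.mapsTo hy') hdown)
      rw [hz, hy_eq]
    rintro _ (⟨y, hy, rfl⟩ | ⟨y, hy, rfl⟩) _ (⟨y', hy', rfl⟩ | ⟨y', hy', rfl⟩) heq <;>
      exact key y hy y' hy' _ _ heq
  · rintro _ (hx | ⟨x, hx, rfl⟩)
    · obtain ⟨y, hy, rfl⟩ := hπ.surjOn hx
      exact ⟨_, Or.inr ⟨y, hy, rfl⟩, by simp [hρ, hl]⟩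
    · obtain ⟨y, hy, rfl⟩ := hπ.surjOn hx
      exact ⟨_, Or.inl ⟨y, hy, rfl⟩, hρ 0 y⟩

/-- If `down_j` (setting the `j`-th coordinate to `0`) is
injective on the vertices of the nonempty 0/1-polytope `P'`, then
`xcs(conv(P' ∪ down_j(P'))) ≤ xcs(P') + 2`. -/
theorem stmt8 {p : ℕ} (P' : Set (Fin p → ℝ)) (h01 : IsZeroOnePolytope P') (hne : P'.Nonempty)
    (j : Fin p)
    (hinj : Set.InjOn (fun x : Fin p → ℝ => Function.update x j 0)
      (Set.extremePoints ℝ P')) :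
    xcs (convexHull ℝ (P' ∪ (fun x : Fin p → ℝ => Function.update x j 0) '' P')) ≤
      xcs P' + 2 := by
  exact Nat.sInf_le
    (.convexHull_union_down h01 j hinj (Nat.sInf_mem h01.exists_hasNiceDescrOfSize))
end
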